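/- (Wiener-type Tauberian theorem for the Gaussian kernel.) Let f : [0,∞) → [0,∞) be a non-decreasing function, let L : (0,∞) → (0,∞) be a measurable, locally bounded, slowly varying function, let b ∈ ℝ and a₀ ∈ ℝ. Assume ∫_0^∞ f(t) e^{−π(t−x)²} dt < ∞ for every x ∈ ℝ and that lim_{x→∞} ( 1 / (e^{bx} L(e^x)) ) · ∫_0^∞ f(t) e^{−π(t−x)²} dt = a₀. Then lim_{x→∞} f(x) / ( e^{bx} L(e^x) ) = a₀ · e^{−b²/(4π)}. -/

import Mathlib

open MeasureTheory Filter Topology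

noncomputable section

open ProbabilityTheory BoundedContinuousFunction

/-- The bounded continuous truncation `s ↦ min (exp (y * s)) K`. -/
def truncExp (y K : ℝ) : ℝ →ᵇ ℝ :=
  BoundedContinuousFunction.ofNormedAddCommGroup (fun s => min (Real.exp (y * s)) |K|)
    (by fun_prop) |K| (fun s => by
      rw [Real.norm_of_nonneg (le_min (Real.exp_pos _).le (abs_nonneg _))]
      exact min_le_right _ _)

lemma truncExp_apply (y K s : ℝ) : truncExp y K s = min (Real.exp (y * s)) |K| := rfl

lemma integral_truncExp_le {ρ : Measure ℝ} [IsProbabilityMeasure ρ] {y : ℝ}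
    (h : Integrable (fun s => Real.exp (y * s)) ρ) (K : ℝ) :
    ∫ s, truncExp y K s ∂ρ ≤ mgf id ρ y :=
  integral_mono ((truncExp y K).integrable ρ) h fun _ => min_le_left _ _

lemma mgf_le_integral_truncExp_add {ρ : Measure ℝ} [IsProbabilityMeasure ρ] {y : ℝ}
    (h : ∀ y, Integrable (fun s => Real.exp (y * s)) ρ) {K : ℝ} (hK : 0 < K) :
    mgf id ρ y ≤ ∫ s, truncExp y K s ∂ρ + mgf id ρ (2 * y) / K := by
  rw [mgf, mgf, ← integral_div, ← integral_add ((truncExp y K).integrable ρ)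
    (by simpa using (h (2 * y)).div_const K)]
  refine integral_mono (h y) (((truncExp y K).integrable ρ).add
    (by simpa using (h (2 * y)).div_const K)) fun s => ?_
  simp only [truncExp_apply, id, abs_of_pos hK]
  have h2 : Real.exp (2 * y * s) = Real.exp (y * s) * Real.exp (y * s) := by
    rw [← Real.exp_add]; ring_nf
  have hp := Real.exp_pos (y * s)
  rcases le_total (Real.exp (y * s)) K with hle | hle
  · rw [min_eq_left hle]
    have : 0 ≤ Real.exp (2 * y * s) / K := by positivity
    linarith
  · have : Real.exp (y * s) ≤ Real.exp (2 * y * s) / K := by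
      rw [h2, le_div_iff₀ hK]; gcongr
    rw [min_eq_right hle]; linarith

lemma integrable_exp_of_integral_truncExp_le {ρ : Measure ℝ} [IsProbabilityMeasure ρ] {y C : ℝ}
    (h : ∀ n : ℕ, ∫ s, truncExp y n s ∂ρ ≤ C) :
    Integrable (fun s => Real.exp (y * s)) ρ := by
  refine ⟨by fun_prop, ?_⟩
  have key : ∫⁻ s, ENNReal.ofReal (Real.exp (y * s)) ∂ρ ≤ ENNReal.ofReal C := by
    have hlim : ∀ s, Tendsto (fun n : ℕ => ENNReal.ofReal (truncExp y n s)) atTop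
        (𝓝 (ENNReal.ofReal (Real.exp (y * s)))) := fun s => by
      refine tendsto_const_nhds.congr' ?_
      filter_upwards [eventually_ge_atTop ⌈Real.exp (y * s)⌉₊] with n hn
      rw [truncExp_apply, min_eq_left]
      simpa using Nat.ceil_le.1 hn
    have h1 := lintegral_liminf_le (μ := ρ) (u := atTop) (f := fun (n : ℕ) s => ENNReal.ofReal (truncExp y n s))
      fun n => by fun_prop
    simp_rw [fun s => (hlim s).liminf_eq] at h1
    refine h1.trans ?_
    refine (liminf_le_liminf (f := atTop) (v := fun _ => ENNReal.ofReal C) (.of_forall fun n => ?_)).trans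
      (by simp)
    rw [← ofReal_integral_eq_lintegral_ofReal ((truncExp y n).integrable ρ)
      (.of_forall fun s => le_min (Real.exp_pos _).le (abs_nonneg _))]
    exact ENNReal.ofReal_le_ofReal (h n)
  rw [hasFiniteIntegral_iff_ofReal (.of_forall fun s => (Real.exp_pos _).le)]
  exact key.trans_lt ENNReal.ofReal_lt_top

lemma MeasureTheory.Measure.ext_of_mgf_id_eq {ρ σ : Measure ℝ} [IsProbabilityMeasure ρ]
    [IsProbabilityMeasure σ] (hρ : ∀ y, Integrable (fun s => Real.exp (y * s)) ρ)
    (h : mgf id ρ = mgf id σ) : ρ = σ := by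
  refine Measure.ext_of_complexMGF_id_eq (funext fun z => eqOn_complexMGF_of_mgf h ?_)
  have : integrableExpSet id ρ = Set.univ := Set.eq_univ_of_forall hρ
  simp [this]

lemma isTightMeasureSet_of_mgf_le {ν : ℕ → ProbabilityMeasure ℝ}
    (hν : ∀ n y, Integrable (fun s => Real.exp (y * s)) (ν n : Measure ℝ)) {C : ℝ}
    (h1 : ∀ n, mgf id (ν n : Measure ℝ) 1 ≤ C) (h2 : ∀ n, mgf id (ν n : Measure ℝ) (-1) ≤ C) :
    IsTightMeasureSet {(ν n : Measure ℝ) | n} := by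
  refine isTightMeasureSet_of_tendsto_measure_norm_gt ?_
  have hlim : Tendsto (fun r : ℝ => ENNReal.ofReal (Real.exp (-r) * C + Real.exp (-r) * C)) atTop
      (𝓝 0) := by
    have := Real.tendsto_exp_neg_atTop_nhds_zero.mul_const C
    simpa using ENNReal.tendsto_ofReal (this.add this)
  refine tendsto_of_tendsto_of_tendsto_of_le_of_le tendsto_const_nhds hlim
    (fun _ => zero_le) fun r => ?_
  simp only [Set.mem_ofPred_eq, iSup_exists, iSup_le_iff]
  rintro _ n rfl
  rw [← ofReal_measureReal]
  refine ENNReal.ofReal_le_ofReal ?_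
  have e1 := measure_ge_le_exp_mul_mgf (μ := (ν n : Measure ℝ)) (X := id) r zero_le_one (hν n 1)
  have e2 := measure_le_le_exp_mul_mgf (μ := (ν n : Measure ℝ)) (X := id) (-r)
    (by norm_num : (-1 : ℝ) ≤ 0) (hν n (-1))
  have e3 : {x : ℝ | r < ‖x‖} ⊆ {x | r ≤ id x} ∪ {x | id x ≤ -r} := fun x hx => by
    rcases lt_abs.1 (show r < |x| from hx) with h | h
    · exact .inl h.le
    · exact .inr (by simp only [id, Set.mem_ofPred_eq]; linarith)
  refine (measureReal_mono e3).trans ((measureReal_union_le _ _).trans (add_le_add ?_ ?_))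
  · refine e1.trans ?_
    rw [neg_one_mul]; gcongr; exact h1 n
  · refine e2.trans ?_
    rw [neg_neg, one_mul]; gcongr; exact h2 n

/-- **Curtiss theorem**: pointwise convergence of finite moment generating functions implies weak
convergence. -/
theorem MeasureTheory.ProbabilityMeasure.tendsto_of_tendsto_mgf {ν : ℕ → ProbabilityMeasure ℝ}
    {σ : ProbabilityMeasure ℝ}
    (hν : ∀ n y, Integrable (fun s => Real.exp (y * s)) (ν n : Measure ℝ))
    (h : ∀ y, Tendsto (fun n => mgf id (ν n : Measure ℝ) y) atTop
      (𝓝 (mgf id (σ : Measure ℝ) y))) :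
    Tendsto ν atTop (𝓝 σ) := by
  have hbdd : ∀ y, ∃ C, ∀ n, mgf id (ν n : Measure ℝ) y ≤ C := fun y => by
    obtain ⟨C, hC⟩ := (h y).bddAbove_range
    exact ⟨C, fun n => hC ⟨n, rfl⟩⟩
  have htight : IsTightMeasureSet {(ν n : Measure ℝ) | n} := by
    obtain ⟨C, hC⟩ := hbdd 1
    obtain ⟨D, hD⟩ := hbdd (-1)
    exact isTightMeasureSet_of_mgf_le hν (fun n => (hC n).trans (le_max_left C D))
      (fun n => (hD n).trans (le_max_right C D))
  refine (Filter.tendsto_iff_ultrafilter _ _ _).2 fun U hU => ?_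
  have hcompact : IsCompact (closure {ν n | n}) :=
    isCompact_closure_of_isTightMeasureSet (by simpa using htight)
  obtain ⟨ρ, -, hρ : Tendsto _ _ _⟩ := hcompact.ultrafilter_le_nhds (U.map ν)
    (.trans (by simp) (monotone_principal subset_closure))
  suffices hs : ρ = σ by rw [hs] at hρ; exact hρ
  rw [ProbabilityMeasure.tendsto_iff_forall_integral_tendsto] at hρ
  have hρ' : ∀ y K, Tendsto (fun n => ∫ s, truncExp y K s ∂(ν n : Measure ℝ)) U
      (𝓝 (∫ s, truncExp y K s ∂(ρ : Measure ℝ))) := fun y K => hρ (truncExp y K)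
  have hint : ∀ y, Integrable (fun s => Real.exp (y * s)) (ρ : Measure ℝ) := fun y => by
    obtain ⟨C, hC⟩ := hbdd y
    refine integrable_exp_of_integral_truncExp_le (C := C) fun n => ?_
    exact le_of_tendsto (hρ' y n)
      (.of_forall fun k => (integral_truncExp_le (hν k y) n).trans (hC k))
  refine ProbabilityMeasure.toMeasure_injective (Measure.ext_of_mgf_id_eq hint (funext fun y => ?_))
  have hUy := fun y => (h y).mono_left hU
  refine le_antisymm ?_ ?_
  · have hT : Tendsto (fun K : ℝ => mgf id (σ : Measure ℝ) y +
        mgf id (ρ : Measure ℝ) (2 * y) / K) atTop (𝓝 (mgf id (σ : Measure ℝ) y + 0)) :=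
      tendsto_const_nhds.add (tendsto_const_nhds.div_atTop tendsto_id)
    rw [add_zero] at hT
    refine ge_of_tendsto hT ((eventually_gt_atTop 0).mono fun K hK => ?_)
    refine (mgf_le_integral_truncExp_add hint hK).trans (add_le_add_left ?_ _)
    exact le_of_tendsto_of_tendsto' (hρ' y K) (hUy y) fun n => integral_truncExp_le (hν n y) K
  · have hT : Tendsto (fun K : ℝ => mgf id (ρ : Measure ℝ) y +
        mgf id (σ : Measure ℝ) (2 * y) / K) atTop (𝓝 (mgf id (ρ : Measure ℝ) y + 0)) :=
      tendsto_const_nhds.add (tendsto_const_nhds.div_atTop tendsto_id)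
    rw [add_zero] at hT
    refine ge_of_tendsto hT ((eventually_gt_atTop 0).mono fun K hK => ?_)
    refine (le_of_tendsto_of_tendsto' (hUy y) ((hρ' y K).add ((hUy (2 * y)).div_const K))
      fun n => mgf_le_integral_truncExp_add (hν n) hK).trans (add_le_add_left ?_ _)
    exact integral_truncExp_le (hint y) K

/-- The Gaussian average of `f` around `x`. -/
def gaussianAverage (f : ℝ → ℝ) (x : ℝ) : ℝ := ∫ t, f t * Real.exp (-(Real.pi * (t - x) ^ 2))

/-- The Gaussian weight times the translate of `f` by `x`, normalized to have mass one. -/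
def gaussianWindow (f : ℝ → ℝ) (x s : ℝ) : ℝ :=
  f (x + s) * Real.exp (-(Real.pi * s ^ 2)) / gaussianAverage f x

/-- The measure with density `gaussianWindow f x`. -/
def gaussianWindowMeasure (f : ℝ → ℝ) (x : ℝ) : Measure ℝ :=
  volume.withDensity fun s => ENNReal.ofReal (gaussianWindow f x s)

section Window

variable {f : ℝ → ℝ}

lemma gaussianWindow_nonneg (hf0 : ∀ t, 0 ≤ f t) (x s : ℝ) : 0 ≤ gaussianWindow f x s :=
  div_nonneg (mul_nonneg (hf0 _) (Real.exp_pos _).le)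
    (integral_nonneg fun _ => mul_nonneg (hf0 _) (Real.exp_pos _).le)

lemma measurable_gaussianWindow (hf : Monotone f) (x : ℝ) : Measurable (gaussianWindow f x) := by
  have := hf.measurable
  unfold gaussianWindow
  fun_prop

lemma gaussianWindow_mul_exp (f : ℝ → ℝ) (x θ s : ℝ) :
    gaussianWindow f x s * Real.exp (θ * s) =
      Real.exp (θ ^ 2 / (4 * Real.pi)) / gaussianAverage f x *
        (f (x + s) * Real.exp (-(Real.pi * (x + s - (x + θ / (2 * Real.pi))) ^ 2))) := by
  have : Real.exp (-(Real.pi * s ^ 2)) * Real.exp (θ * s) = Real.exp (θ ^ 2 / (4 * Real.pi)) *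
      Real.exp (-(Real.pi * (x + s - (x + θ / (2 * Real.pi))) ^ 2)) := by
    rw [← Real.exp_add, ← Real.exp_add]
    congr 1
    have := Real.pi_ne_zero
    field_simp
    ring
  calc _ = f (x + s) * (Real.exp (-(Real.pi * s ^ 2)) * Real.exp (θ * s)) /
        gaussianAverage f x := by unfold gaussianWindow; ring
    _ = _ := by rw [this]; ring

lemma integrable_gaussianWindow_mul_exp
    (hint : ∀ x, Integrable fun t => f t * Real.exp (-(Real.pi * (t - x) ^ 2)))
    (x θ : ℝ) :
    Integrable fun s => gaussianWindow f x s * Real.exp (θ * s) := by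
  simp_rw [gaussianWindow_mul_exp]
  exact ((hint (x + θ / (2 * Real.pi))).comp_add_left x).const_mul _

lemma integral_gaussianWindow_mul_exp (f : ℝ → ℝ) (x θ : ℝ) :
    ∫ s, gaussianWindow f x s * Real.exp (θ * s) = Real.exp (θ ^ 2 / (4 * Real.pi)) *
      (gaussianAverage f (x + θ / (2 * Real.pi)) / gaussianAverage f x) := by
  simp_rw [gaussianWindow_mul_exp]
  rw [integral_const_mul, integral_add_left_eq_self
    (fun t => f t * Real.exp (-(Real.pi * (t - (x + θ / (2 * Real.pi))) ^ 2))) x]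
  rw [← gaussianAverage]
  ring

lemma integrable_exp_gaussianWindowMeasure (hf : Monotone f) (hf0 : ∀ t, 0 ≤ f t)
    (hint : ∀ x, Integrable fun t => f t * Real.exp (-(Real.pi * (t - x) ^ 2)))
    (x θ : ℝ) :
    Integrable (fun s => Real.exp (θ * s)) (gaussianWindowMeasure f x) := by
  rw [gaussianWindowMeasure, integrable_withDensity_iff
    (measurable_gaussianWindow hf x).ennreal_ofReal (by simp)]
  simpa only [ENNReal.toReal_ofReal (gaussianWindow_nonneg hf0 x _), mul_comm] using
    integrable_gaussianWindow_mul_exp hint x θ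

lemma mgf_gaussianWindowMeasure (hf : Monotone f) (hf0 : ∀ t, 0 ≤ f t)
    (x θ : ℝ) :
    mgf id (gaussianWindowMeasure f x) θ = Real.exp (θ ^ 2 / (4 * Real.pi)) *
      (gaussianAverage f (x + θ / (2 * Real.pi)) / gaussianAverage f x) := by
  rw [mgf, gaussianWindowMeasure, integral_withDensity_eq_integral_toReal_smul
    (measurable_gaussianWindow hf x).ennreal_ofReal (by simp),
    ← integral_gaussianWindow_mul_exp]
  simp only [ENNReal.toReal_ofReal (gaussianWindow_nonneg hf0 x _), smul_eq_mul, id]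

lemma integrable_gaussianWindow
    (hint : ∀ x, Integrable fun t => f t * Real.exp (-(Real.pi * (t - x) ^ 2)))
    (x : ℝ) : Integrable (gaussianWindow f x) := by
  simpa using integrable_gaussianWindow_mul_exp hint x 0

lemma gaussianWindowMeasure_real_apply (hf0 : ∀ t, 0 ≤ f t)
    (hint : ∀ x, Integrable fun t => f t * Real.exp (-(Real.pi * (t - x) ^ 2)))
    (x : ℝ) {A : Set ℝ} (hA : MeasurableSet A) :
    (gaussianWindowMeasure f x).real A = ∫ s in A, gaussianWindow f x s := by
  rw [measureReal_def, gaussianWindowMeasure, withDensity_apply _ hA,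
    ← ofReal_integral_eq_lintegral_ofReal (integrable_gaussianWindow hint x).integrableOn
      (.of_forall (gaussianWindow_nonneg hf0 x)),
    ENNReal.toReal_ofReal (integral_nonneg (gaussianWindow_nonneg hf0 x))]

lemma isProbabilityMeasure_gaussianWindowMeasure (hf0 : ∀ t, 0 ≤ f t)
    (hint : ∀ x, Integrable fun t => f t * Real.exp (-(Real.pi * (t - x) ^ 2)))
    {x : ℝ} (hx : 0 < gaussianAverage f x) :
    IsProbabilityMeasure (gaussianWindowMeasure f x) := by
  constructor
  have h := integral_gaussianWindow_mul_exp f x 0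
  simp only [zero_mul, Real.exp_zero, mul_one, ne_eq, OfNat.ofNat_ne_zero, not_false_eq_true,
    zero_pow, zero_div, add_zero, div_self hx.ne'] at h
  rw [gaussianWindowMeasure, withDensity_apply _ .univ, Measure.restrict_univ,
    ← ofReal_integral_eq_lintegral_ofReal (integrable_gaussianWindow hint x)
      (.of_forall (gaussianWindow_nonneg hf0 x)), h, ENNReal.ofReal_one]

/-- The variance `1 / (2 * π)` of the probability density `exp (-π * s ^ 2)`. -/
def gaussVar : NNReal := Real.toNNReal (1 / (2 * Real.pi))

lemma coe_gaussVar : (gaussVar : ℝ) = 1 / (2 * Real.pi) :=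
  Real.coe_toNNReal _ (by positivity)

lemma gaussVar_ne_zero : gaussVar ≠ 0 := by
  rw [← NNReal.coe_ne_zero, coe_gaussVar]; positivity

lemma mgf_gaussianReal_gaussVar (b θ : ℝ) :
    mgf id (gaussianReal (b / (2 * Real.pi)) gaussVar) θ =
      Real.exp (θ ^ 2 / (4 * Real.pi)) * Real.exp (b * (θ / (2 * Real.pi))) := by
  rw [mgf_gaussianReal Measure.map_id, coe_gaussVar, ← Real.exp_add]
  congr 1
  field_simp
  ring

lemma gaussianPDFReal_gaussVar (b s : ℝ) :
    gaussianPDFReal (b / (2 * Real.pi)) gaussVar s =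
      Real.exp (-(b ^ 2) / (4 * Real.pi)) * Real.exp (b * s) * Real.exp (-(Real.pi * s ^ 2)) := by
  have h : 2 * Real.pi * (1 / (2 * Real.pi)) = 1 := by field_simp
  rw [gaussianPDFReal, coe_gaussVar, h, Real.sqrt_one, inv_one, one_mul, ← Real.exp_add,
    ← Real.exp_add]
  congr 1
  field_simp
  ring

lemma integrable_exp_neg_pi_mul_sq : Integrable fun s : ℝ => Real.exp (-(Real.pi * s ^ 2)) := by
  simpa using integrable_exp_neg_mul_sq Real.pi_pos

lemma gaussianReal_gaussVar_real_apply (b : ℝ) (A : Set ℝ) :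
    (gaussianReal (b / (2 * Real.pi)) gaussVar).real A =
      ∫ s in A, gaussianPDFReal (b / (2 * Real.pi)) gaussVar s := by
  rw [measureReal_def, gaussianReal_apply_eq_integral _ gaussVar_ne_zero,
    ENNReal.toReal_ofReal (integral_nonneg fun s => gaussianPDFReal_nonneg _ _ s)]

lemma gaussianReal_gaussVar_real_le {b c : ℝ} {A : Set ℝ} (hA : MeasurableSet A)
    (hc : ∀ s ∈ A, b * s ≤ c) :
    (gaussianReal (b / (2 * Real.pi)) gaussVar).real A ≤
      Real.exp (-(b ^ 2) / (4 * Real.pi)) * Real.exp c *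
        ∫ s in A, Real.exp (-(Real.pi * s ^ 2)) := by
  rw [gaussianReal_gaussVar_real_apply, ← integral_const_mul]
  refine setIntegral_mono_on (integrable_gaussianPDFReal _ _).integrableOn
    (integrable_exp_neg_pi_mul_sq.const_mul _).integrableOn hA fun s hs => ?_
  rw [gaussianPDFReal_gaussVar]
  gcongr
  exact hc s hs

lemma le_gaussianReal_gaussVar_real {b c : ℝ} {A : Set ℝ} (hA : MeasurableSet A)
    (hc : ∀ s ∈ A, c ≤ b * s) :
    Real.exp (-(b ^ 2) / (4 * Real.pi)) * Real.exp c *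
        ∫ s in A, Real.exp (-(Real.pi * s ^ 2)) ≤
      (gaussianReal (b / (2 * Real.pi)) gaussVar).real A := by
  rw [gaussianReal_gaussVar_real_apply, ← integral_const_mul]
  refine setIntegral_mono_on (integrable_exp_neg_pi_mul_sq.const_mul _).integrableOn
    (integrable_gaussianPDFReal _ _).integrableOn hA fun s hs => ?_
  rw [gaussianPDFReal_gaussVar]
  gcongr
  exact hc s hs

lemma setIntegral_exp_neg_pi_mul_sq_pos {a c : ℝ} (h : a < c) :
    0 < ∫ s in Set.Icc a c, Real.exp (-(Real.pi * s ^ 2)) := by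
  rw [setIntegral_pos_iff_support_of_nonneg_ae (.of_forall fun s => (Real.exp_pos _).le)
    integrable_exp_neg_pi_mul_sq.integrableOn]
  have : Function.support (fun s : ℝ => Real.exp (-(Real.pi * s ^ 2))) = Set.univ :=
    Set.eq_univ_of_forall fun s => (Real.exp_pos _).ne'
  simp [this, h]

lemma mul_setIntegral_le_gaussianWindowMeasure (hf : Monotone f) (hf0 : ∀ t, 0 ≤ f t)
    (hint : ∀ x, Integrable fun t => f t * Real.exp (-(Real.pi * (t - x) ^ 2)))
    {x : ℝ} (hx : 0 < gaussianAverage f x) (δ : ℝ) :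
    f x / gaussianAverage f x * ∫ s in Set.Icc 0 δ, Real.exp (-(Real.pi * s ^ 2)) ≤
      (gaussianWindowMeasure f x).real (Set.Icc 0 δ) := by
  rw [gaussianWindowMeasure_real_apply hf0 hint x measurableSet_Icc, ← integral_const_mul]
  refine setIntegral_mono_on (integrable_exp_neg_pi_mul_sq.const_mul _).integrableOn
    (integrable_gaussianWindow hint x).integrableOn measurableSet_Icc fun s hs => ?_
  rw [gaussianWindow, div_mul_eq_mul_div]
  gcongr
  exact hf (by linarith [hs.1])

lemma gaussianWindowMeasure_le_mul_setIntegral (hf : Monotone f) (hf0 : ∀ t, 0 ≤ f t)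
    (hint : ∀ x, Integrable fun t => f t * Real.exp (-(Real.pi * (t - x) ^ 2)))
    {x : ℝ} (hx : 0 < gaussianAverage f x) (δ : ℝ) :
    (gaussianWindowMeasure f x).real (Set.Icc (-δ) 0) ≤
      f x / gaussianAverage f x * ∫ s in Set.Icc (-δ) 0, Real.exp (-(Real.pi * s ^ 2)) := by
  rw [gaussianWindowMeasure_real_apply hf0 hint x measurableSet_Icc, ← integral_const_mul]
  refine setIntegral_mono_on (integrable_gaussianWindow hint x).integrableOn
    (integrable_exp_neg_pi_mul_sq.const_mul _).integrableOn measurableSet_Icc fun s hs => ?_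
  rw [gaussianWindow, div_mul_eq_mul_div]
  gcongr
  exact hf (by linarith [hs.2])

lemma tendsto_gaussianWindowMeasure_Icc (hf : Monotone f) (hf0 : ∀ t, 0 ≤ f t)
    (hint : ∀ x, Integrable fun t => f t * Real.exp (-(Real.pi * (t - x) ^ 2)))
    (hpos : ∀ x, 0 < gaussianAverage f x) {u : ℕ → ℝ} {b : ℝ}
    (hu : ∀ y, Tendsto (fun n => gaussianAverage f (u n + y) / gaussianAverage f (u n)) atTop
      (𝓝 (Real.exp (b * y)))) (c d : ℝ) :
    Tendsto (fun n => (gaussianWindowMeasure f (u n)).real (Set.Icc c d)) atTop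
      (𝓝 ((gaussianReal (b / (2 * Real.pi)) gaussVar).real (Set.Icc c d))) := by
  let ν : ℕ → ProbabilityMeasure ℝ := fun n => ⟨gaussianWindowMeasure f (u n),
    isProbabilityMeasure_gaussianWindowMeasure hf0 hint (hpos _)⟩
  let σ : ProbabilityMeasure ℝ := ⟨gaussianReal (b / (2 * Real.pi)) gaussVar, inferInstance⟩
  have key : Tendsto ν atTop (𝓝 σ) := by
    refine ProbabilityMeasure.tendsto_of_tendsto_mgf
      (fun n y => integrable_exp_gaussianWindowMeasure hf hf0 hint (u n) y) fun y => ?_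
    change Tendsto (fun n => mgf id (gaussianWindowMeasure f (u n)) y) atTop
      (𝓝 (mgf id (gaussianReal (b / (2 * Real.pi)) gaussVar) y))
    simp_rw [mgf_gaussianWindowMeasure hf hf0, mgf_gaussianReal_gaussVar]
    exact (hu _).const_mul _
  have hnull : (σ : Measure ℝ) (frontier (Set.Icc c d)) = 0 := by
    have := nullSingletonClass_gaussianReal (μ := b / (2 * Real.pi)) gaussVar_ne_zero
    refine Set.Countable.measure_zero (μ := gaussianReal (b / (2 * Real.pi)) gaussVar) ?_
    rcases le_or_gt c d with h | h
    · rw [frontier_Icc h]; exact (Set.toFinite _).countable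
    · simp [Set.Icc_eq_empty_of_lt h]
  exact (ENNReal.tendsto_toReal (measure_ne_top _ _)).comp
    (ProbabilityMeasure.tendsto_measure_of_null_frontier_of_tendsto' key hnull)

lemma tendsto_div_gaussianAverage (hf : Monotone f) (hf0 : ∀ t, 0 ≤ f t)
    (hint : ∀ x, Integrable fun t => f t * Real.exp (-(Real.pi * (t - x) ^ 2)))
    (hpos : ∀ x, 0 < gaussianAverage f x) {u : ℕ → ℝ} {b : ℝ}
    (hu : ∀ y, Tendsto (fun n => gaussianAverage f (u n + y) / gaussianAverage f (u n)) atTop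
      (𝓝 (Real.exp (b * y)))) :
    Tendsto (fun n => f (u n) / gaussianAverage f (u n)) atTop
      (𝓝 (Real.exp (-(b ^ 2) / (4 * Real.pi)))) := by
  have hW := tendsto_gaussianWindowMeasure_Icc hf hf0 hint hpos hu
  have hexp : Tendsto (fun c => Real.exp (-(b ^ 2) / (4 * Real.pi)) * Real.exp c) (𝓝 0)
      (𝓝 (Real.exp (-(b ^ 2) / (4 * Real.pi)))) :=
    Continuous.tendsto' (by fun_prop) _ _ (by simp)
  have habs : Tendsto (fun δ => |b| * δ) (𝓝[>] 0) (𝓝 0) :=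
    (Continuous.tendsto' (by fun_prop) _ _ (by simp)).mono_left nhdsWithin_le_nhds
  have hneg : Tendsto (fun δ => -(|b| * δ)) (𝓝[>] 0) (𝓝 0) := by simpa using habs.neg
  rw [tendsto_order]
  constructor
  · intro a ha
    obtain ⟨δ, hδ, hδ0⟩ := (((hexp.comp hneg).eventually_const_lt ha).and
      self_mem_nhdsWithin).exists
    have hw := setIntegral_exp_neg_pi_mul_sq_pos (neg_lt_zero.2 (show 0 < δ from hδ0))
    have hle := le_gaussianReal_gaussVar_real (b := b) (c := -(|b| * δ)) (A := Set.Icc (-δ) 0)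
      measurableSet_Icc fun s hs => by
        have h1 : |b * s| ≤ |b| * δ := by
          rw [abs_mul]; gcongr; exact abs_le.2 ⟨hs.1, hs.2.trans (le_of_lt hδ0)⟩
        exact (abs_le.1 h1).1
    filter_upwards [(hW (-δ) 0).eventually_const_lt
      ((mul_lt_mul_of_pos_right hδ hw).trans_le hle)] with n hn
    exact lt_of_mul_lt_mul_right
      (hn.trans_le (gaussianWindowMeasure_le_mul_setIntegral hf hf0 hint (hpos _) δ)) hw.le
  · intro a ha
    obtain ⟨δ, hδ, hδ0⟩ := (((hexp.comp habs).eventually_lt_const ha).and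
      self_mem_nhdsWithin).exists
    have hw := setIntegral_exp_neg_pi_mul_sq_pos (show 0 < δ from hδ0)
    have hle := gaussianReal_gaussVar_real_le (b := b) (c := |b| * δ) (A := Set.Icc 0 δ)
      measurableSet_Icc fun s hs => by
        have h1 : |b * s| ≤ |b| * δ := by
          rw [abs_mul]; gcongr; rw [abs_of_nonneg hs.1]; exact hs.2
        exact (abs_le.1 h1).2
    filter_upwards [(hW 0 δ).eventually_lt_const
      (hle.trans_lt (mul_lt_mul_of_pos_right hδ hw))] with n hn
    exact lt_of_mul_lt_mul_right
      ((mul_setIntegral_le_gaussianWindowMeasure hf hf0 hint (hpos _) δ).trans_lt hn) hw.le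

lemma mul_setIntegral_le_gaussianAverage (hf : Monotone f) (hf0 : ∀ t, 0 ≤ f t)
    (hint : ∀ x, Integrable fun t => f t * Real.exp (-(Real.pi * (t - x) ^ 2)))
    (x : ℝ) :
    f x * ∫ s in Set.Icc (0 : ℝ) 1, Real.exp (-(Real.pi * s ^ 2)) ≤ gaussianAverage f x := by
  have h0 : Integrable fun s => f (x + s) * Real.exp (-(Real.pi * s ^ 2)) := by
    simpa using (hint x).comp_add_left x
  have h1 : gaussianAverage f x = ∫ s, f (x + s) * Real.exp (-(Real.pi * s ^ 2)) := by
    rw [gaussianAverage, ← integral_add_left_eq_self _ x]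
    simp
  rw [h1, ← integral_const_mul]
  refine le_trans ?_ (setIntegral_le_integral (s := Set.Icc 0 1) h0
    (.of_forall fun s => mul_nonneg (hf0 _) (Real.exp_pos _).le))
  refine setIntegral_mono_on (integrable_exp_neg_pi_mul_sq.const_mul _).integrableOn
    h0.integrableOn measurableSet_Icc fun s hs => ?_
  gcongr
  exact hf (by linarith [hs.1])

lemma gaussianAverage_pos (hf : Monotone f) (hf0 : ∀ t, 0 ≤ f t)
    (hint : ∀ x, Integrable fun t => f t * Real.exp (-(Real.pi * (t - x) ^ 2)))
    {T : ℝ} (hT : 0 < f T) (x : ℝ) : 0 < gaussianAverage f x := by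
  rw [gaussianAverage, integral_pos_iff_support_of_nonneg
    (fun t => mul_nonneg (hf0 _) (Real.exp_pos _).le) (hint x)]
  refine lt_of_lt_of_le (?_ : 0 < volume (Set.Ici T)) (measure_mono fun t ht => ?_)
  · simp
  · exact (mul_pos (hT.trans_le (hf ht)) (Real.exp_pos _)).ne'

/-- A Tauberian theorem for Gaussian averages of a nonnegative monotone function. -/
theorem tendsto_div_of_tendsto_gaussianAverage_div (hf : Monotone f) (hf0 : ∀ t, 0 ≤ f t)
    (hint : ∀ x, Integrable fun t => f t * Real.exp (-(Real.pi * (t - x) ^ 2)))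
    {g : ℝ → ℝ} (hg : ∀ x, 0 < g x) {a b : ℝ}
    (hgb : ∀ y, Tendsto (fun x => g (x + y) / g x) atTop (𝓝 (Real.exp (b * y))))
    (hlim : Tendsto (fun x => gaussianAverage f x / g x) atTop (𝓝 a)) :
    Tendsto (fun x => f x / g x) atTop (𝓝 (a * Real.exp (-(b ^ 2) / (4 * Real.pi)))) := by
  have hw := setIntegral_exp_neg_pi_mul_sq_pos (zero_lt_one' ℝ)
  rcases eq_or_ne a 0 with rfl | ha
  · rw [zero_mul]
    have h2 := hlim.div_const (∫ s in Set.Icc (0 : ℝ) 1, Real.exp (-(Real.pi * s ^ 2)))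
    rw [zero_div] at h2
    refine squeeze_zero (fun x => div_nonneg (hf0 x) (hg x).le) (fun x => ?_) h2
    rw [le_div_iff₀ hw, div_mul_eq_mul_div]
    have := hg x
    gcongr
    exact mul_setIntegral_le_gaussianAverage hf hf0 hint x
  · have hpos : ∀ x, 0 < gaussianAverage f x := by
      have : ∃ T, 0 < f T := by
        by_contra! h
        have h0 : f = 0 := funext fun t => le_antisymm (h t) (hf0 t)
        refine ha (tendsto_nhds_unique hlim ?_)
        simp [gaussianAverage, h0]
      obtain ⟨T, hT⟩ := this
      exact gaussianAverage_pos hf hf0 hint hT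
    refine tendsto_of_seq_tendsto fun u hu => ?_
    have hlim' := hlim.comp hu
    have key := tendsto_div_gaussianAverage hf hf0 hint hpos (u := u) (b := b) fun y => by
      have h1 := (hlim.comp (tendsto_atTop_add_const_right _ y hu)).mul ((hgb y).comp hu)
      have h2 := h1.div hlim' ha
      rw [mul_div_cancel_left₀ _ ha] at h2
      refine h2.congr fun n => ?_
      have e1 := (hg (u n)).ne'
      have e2 := (hg (u n + y)).ne'
      have e3 := (hpos (u n)).ne'
      simp only [Function.comp, Pi.div_apply]
      field_simp
    refine (hlim'.mul key).congr fun n => ?_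
    have e1 := (hg (u n)).ne'
    have e3 := (hpos (u n)).ne'
    simp only [Function.comp]
    field_simp

end Window

lemma tendsto_exp_mul_slowlyVarying {L : ℝ → ℝ}
    (hL : ∀ a : ℝ, 0 < a → Tendsto (fun t : ℝ => L (a * t) / L t) atTop (𝓝 1)) (b y : ℝ) :
    Tendsto (fun x => Real.exp (b * (x + y)) * L (Real.exp (x + y)) /
      (Real.exp (b * x) * L (Real.exp x))) atTop (𝓝 (Real.exp (b * y))) := by
  have h := ((hL _ (Real.exp_pos y)).comp Real.tendsto_exp_atTop).const_mul (Real.exp (b * y))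
  rw [mul_one] at h
  refine h.congr fun x => ?_
  have hx := (Real.exp_pos (b * x)).ne'
  rw [Function.comp, mul_add, Real.exp_add, Real.exp_add, mul_comm (Real.exp x)]
  field_simp

/-- Wiener-type Tauberian theorem for the Gaussian kernel. -/
theorem statement19 (f L : ℝ → ℝ) (b a₀ : ℝ)
    (hf_mono : MonotoneOn f (Set.Ici 0)) (hf_nonneg : ∀ x : ℝ, 0 ≤ x → 0 ≤ f x)
    (hL_meas : Measurable L) (hL_pos : ∀ y : ℝ, 0 < y → 0 < L y)
    (hL_loc : ∀ K : Set ℝ, IsCompact K → K ⊆ Set.Ioi 0 → ∃ M : ℝ, ∀ y ∈ K, L y ≤ M)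
    (hL_slow : ∀ a : ℝ, 0 < a → Tendsto (fun t : ℝ => L (a * t) / L t) atTop (𝓝 1))
    (hint : ∀ x : ℝ, IntegrableOn (fun t : ℝ => f t * Real.exp (-(Real.pi * (t - x) ^ 2)))
      (Set.Ioi 0))
    (hlim : Tendsto (fun x : ℝ =>
        (∫ t in Set.Ioi (0 : ℝ), f t * Real.exp (-(Real.pi * (t - x) ^ 2))) /
          (Real.exp (b * x) * L (Real.exp x))) atTop (𝓝 a₀)) :
    Tendsto (fun x : ℝ => f x / (Real.exp (b * x) * L (Real.exp x))) atTop
      (𝓝 (a₀ * Real.exp (-(b ^ 2) / (4 * Real.pi)))) := by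
  let f₀ : ℝ → ℝ := (Set.Ioi 0).indicator f
  have hf₀ : ∀ x, 0 < x → f₀ x = f x := fun x hx => Set.indicator_of_mem (Set.mem_Ioi.2 hx) f
  have hf₀_nonneg : ∀ t, 0 ≤ f₀ t := Set.indicator_nonneg fun t ht => hf_nonneg t (le_of_lt ht)
  have hf₀_mono : Monotone f₀ := fun s t hst => by
    rcases le_or_gt s 0 with hs | hs
    · rw [show f₀ s = 0 from Set.indicator_of_notMem (by simpa using hs) f]
      exact hf₀_nonneg t
    · rw [hf₀ s hs, hf₀ t (hs.trans_le hst)]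
      exact hf_mono hs.le (hs.le.trans hst) hst
  have hmul : ∀ x, (fun t => f₀ t * Real.exp (-(Real.pi * (t - x) ^ 2))) =
      (Set.Ioi 0).indicator fun t => f t * Real.exp (-(Real.pi * (t - x) ^ 2)) := fun x =>
    (funext fun t => Set.indicator_mul_left (Set.Ioi 0) f
      fun t => Real.exp (-(Real.pi * (t - x) ^ 2))).symm
  have hint₀ : ∀ x, Integrable fun t => f₀ t * Real.exp (-(Real.pi * (t - x) ^ 2)) := fun x => by
    rw [hmul, integrable_indicator_iff measurableSet_Ioi]
    exact hint x
  have hlim₀ : Tendsto (fun x => gaussianAverage f₀ x / (Real.exp (b * x) * L (Real.exp x)))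
      atTop (𝓝 a₀) := by
    simpa only [gaussianAverage, hmul, integral_indicator measurableSet_Ioi] using hlim
  refine (tendsto_div_of_tendsto_gaussianAverage_div hf₀_mono hf₀_nonneg hint₀
    (fun x => mul_pos (Real.exp_pos _) (hL_pos _ (Real.exp_pos _)))
    (tendsto_exp_mul_slowlyVarying hL_slow b) hlim₀).congr' ?_
  filter_upwards [eventually_gt_atTop 0] with x hx
  rw [hf₀ x hx]
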